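/- For all axially symmetric functions σ, ω on S² (smooth functions of θ ∈ [0,π]) with σ(0) = σ(π) and boundary conditions ω(0) = 4J, ω(π) = -4J, the mass functional M(σ,ω) = ∫₀^π ((σ')² + 4σ + (ω')²/η²) sin θ dθ with η = e^σ sin²θ satisfies 2|J| ≤ e^{(M(σ,ω)-8)/8}. -/

import Mathlib

open Real Set

lemma aux_cont (ω : ℝ → ℝ) (hd : Differentiable ℝ ω) (K : ℝ)
    (h : ∀ θ ∈ Ioo (0 : ℝ) π, |deriv ω θ| ≤ K * Real.sin θ ^ 2) :
    ContinuousOn (fun θ => (ω θ - ω 0) / (1 - Real.cos θ)) (Icc 0 π) := by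
  intro x hx
  rcases eq_or_lt_of_le hx.1 with h0 | h0
  · subst h0
    have key : Filter.Tendsto (fun θ => (ω θ - ω 0) / (1 - Real.cos θ))
        (nhdsWithin 0 (Ioi 0)) (nhds 0) := by
      refine HasDerivAt.lhopital_zero_right_on_Ioo (f' := deriv ω) (g' := Real.sin) pi_pos
        (fun x _ => (hd x).hasDerivAt.sub_const _) (fun x _ => ?_) (fun x hx => ?_) ?_ ?_ ?_
      · simpa using (Real.hasDerivAt_cos x).const_sub 1
      · exact (Real.sin_pos_of_mem_Ioo hx).ne'
      · have : Continuous (fun θ => ω θ - ω 0) := by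
          have := hd.continuous
          fun_prop
        have := this.tendsto 0
        simp only [sub_self] at this
        exact this.mono_left nhdsWithin_le_nhds
      · have : Continuous (fun θ => 1 - Real.cos θ) := by fun_prop
        have := this.tendsto 0
        simp only [sub_self, Real.cos_zero] at this
        exact this.mono_left nhdsWithin_le_nhds
      · have h2 : Filter.Tendsto (fun θ => K * Real.sin θ) (nhdsWithin 0 (Ioi 0)) (nhds 0) := by
          have : Continuous (fun θ => K * Real.sin θ) := by fun_prop
          have := this.tendsto 0
          simp only [Real.sin_zero, mul_zero] at this
          exact this.mono_left nhdsWithin_le_nhds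
        refine squeeze_zero_norm' ?_ h2
        filter_upwards [Ioo_mem_nhdsGT pi_pos] with θ hθ
        have hs := Real.sin_pos_of_mem_Ioo hθ
        rw [norm_div, Real.norm_eq_abs, Real.norm_eq_abs, abs_of_pos hs, div_le_iff₀ hs]
        have := h θ hθ
        nlinarith
    have h1 : ContinuousWithinAt (fun θ => (ω θ - ω 0) / (1 - Real.cos θ)) (Ioi 0) 0 := by
      unfold ContinuousWithinAt
      simpa using key
    have h2 := continuousWithinAt_insert_self.2 h1
    rw [Ioi_insert] at h2
    exact h2.mono Icc_subset_Ici_self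
  · apply ContinuousAt.continuousWithinAt
    have hc : Real.cos x < 1 := by
      rw [← Real.cos_zero]
      exact Real.cos_lt_cos_of_nonneg_of_le_pi le_rfl hx.2 h0
    have := hd.continuous
    apply ContinuousAt.div
    · fun_prop
    · fun_prop
    · linarith

lemma aux_ineq (s c e x w p a A B y z E : ℝ) (hs : 0 < s) (hsc : s ^ 2 + c ^ 2 = 1)
    (he : 0 < e) (hE : E = e * s ^ 2) (hy : x = y - 2 * c / s) (hz : w = z * E)
    (hA : A = p ^ 2 + E ^ 2) (hB : B = (p + 2 * a) ^ 2 + E ^ 2) :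
    4 * (p * w + E * (E * y)) / A - 4 * ((p + 2 * a) * w + E * (E * y)) / B - 8 / s
      + 4 * s - 4 * x * c ≤ (x ^ 2 + w ^ 2 / E ^ 2) * s := by
  have hE0 : 0 < E := by rw [hE]; positivity
  have hA0 : 0 < A := by rw [hA]; positivity
  have hB0 : 0 < B := by rw [hB]; positivity
  obtain ⟨α, hα⟩ : ∃ α, α = E * (p / A - (p + 2 * a) / B) := ⟨_, rfl⟩
  obtain ⟨β, hβ⟩ : ∃ β, β = E ^ 2 * (1 / A - 1 / B) := ⟨_, rfl⟩
  have h1 : α ^ 2 + β ^ 2 = 4 * a ^ 2 * E ^ 2 / (A * B) := by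
    rw [hα, hβ]
    field_simp
    rw [hA, hB]
    ring
  have h2 : α ^ 2 + β ^ 2 ≤ 1 := by
    rw [h1, div_le_one (by positivity), hA, hB]
    nlinarith [sq_nonneg (p * (p + 2 * a) + E ^ 2)]
  have h3 : 4 * (p * w + E * (E * y)) / A - 4 * ((p + 2 * a) * w + E * (E * y)) / B
      = 4 * (z * α + y * β) := by
    rw [hα, hβ, hz]
    field_simp
    ring
  have h4 : w ^ 2 / E ^ 2 = z ^ 2 := by
    rw [hz]; field_simp
  have h5 : (x ^ 2 + z ^ 2) * s - (4 * (z * α + y * β) - 8 / s + 4 * s - 4 * x * c)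
      = s * ((y - 2 * β / s) ^ 2 + (z - 2 * α / s) ^ 2) + 4 * (1 - α ^ 2 - β ^ 2) / s := by
    rw [hy]
    field_simp
    have : c ^ 2 = 1 - s ^ 2 := by linarith
    ring_nf
    rw [this]
    ring
  have h6 : 0 ≤ s * ((y - 2 * β / s) ^ 2 + (z - 2 * α / s) ^ 2)
      + 4 * (1 - α ^ 2 - β ^ 2) / s := by
    have : 0 ≤ 1 - α ^ 2 - β ^ 2 := by linarith
    positivity
  rw [h3, h4]
  linarith

lemma aux_integrable (σ ω : ℝ → ℝ)
    (hσ : ContDiff ℝ (⊤ : ℕ∞) σ) (hω : ContDiff ℝ (⊤ : ℕ∞) ω)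
    (η : ℝ → ℝ) (hη : η = fun θ => Real.exp (σ θ) * Real.sin θ ^ 2)
    (C : ℝ) (hbd : ∀ θ ∈ Ioo (0 : ℝ) π, |deriv ω θ / η θ| ≤ C) :
    MeasureTheory.IntegrableOn (fun θ =>
      ((deriv σ θ) ^ 2 + 4 * σ θ + (deriv ω θ) ^ 2 / (η θ) ^ 2) *
        Real.sin θ) (Icc 0 π) := by
  have c1 : Continuous (deriv σ) := hσ.continuous_deriv (by simp)
  have c2 : Continuous (deriv ω) := hω.continuous_deriv (by simp)
  have c3 : Continuous σ := hσ.continuous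
  have c4 : Continuous η := by rw [hη]; fun_prop
  have e : (fun θ => ((deriv σ θ) ^ 2 + 4 * σ θ + (deriv ω θ) ^ 2 / (η θ) ^ 2) * Real.sin θ)
    = fun θ => ((deriv σ θ) ^ 2 + 4 * σ θ) * Real.sin θ
      + (deriv ω θ) ^ 2 / (η θ) ^ 2 * Real.sin θ := by
    funext θ; ring
  rw [e]
  apply MeasureTheory.IntegrableOn.add
  · apply Continuous.integrableOn_Icc
    fun_prop
  · rw [integrableOn_Icc_iff_integrableOn_Ioo]
    refine MeasureTheory.Measure.integrableOn_of_bounded (M := C ^ 2) (by simp) ?_ ?_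
    · apply Measurable.aestronglyMeasurable
      exact ((c2.measurable.pow_const 2).div (c4.measurable.pow_const 2)).mul
        Real.measurable_sin
    · refine (MeasureTheory.ae_restrict_iff' measurableSet_Ioo).2 (Filter.Eventually.of_forall ?_)
      intro θ hθ
      have := hbd θ hθ
      rw [← div_pow, norm_mul, norm_pow, Real.norm_eq_abs, Real.norm_eq_abs]
      have h1 := Real.abs_sin_le_one θ
      have h2 : |deriv ω θ / η θ| ^ 2 ≤ C ^ 2 := by gcongr
      calc _ ≤ C ^ 2 * 1 := by gcongr
        _ = _ := by ring


/-- Lemma 4.1 of Aceña–Dain–Gabach Clément: for all smooth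
axisymmetric `σ, ω` with `σ(0)=σ(π)`, `ω(0)=4J`, `ω(π)=-4J`, the mass
functional `M = ∫₀^π ((σ')² + 4σ + (ω')²/η²) sinθ dθ` with `η = e^σ sin²θ`
satisfies `2|J| ≤ e^{(M-8)/8}`. -/
theorem stmt_14 (J : ℝ) (σ ω : ℝ → ℝ)
    (hσ : ContDiff ℝ (⊤ : ℕ∞) σ) (hω : ContDiff ℝ (⊤ : ℕ∞) ω)
    (hbcσ : σ 0 = σ π) (hω0 : ω 0 = 4 * J) (hωπ : ω π = -(4 * J))
    (η : ℝ → ℝ) (hη : η = fun θ => Real.exp (σ θ) * Real.sin θ ^ 2)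
    (hbd : ∃ C : ℝ, ∀ θ ∈ Ioo (0 : ℝ) π, |deriv ω θ / η θ| ≤ C)
    (M : ℝ)
    (hM : M = ∫ θ in (0)..π,
      ((deriv σ θ) ^ 2 + 4 * σ θ + (deriv ω θ) ^ 2 / (η θ) ^ 2) *
        Real.sin θ) :
    2 * |J| ≤ Real.exp ((M - 8) / 8) := by
  by_cases hJ : J = 0
  · subst hJ; simp; positivity
  obtain ⟨C, hC⟩ := hbd
  have dσ : Differentiable ℝ σ := hσ.differentiable (by simp)
  have dω : Differentiable ℝ ω := hω.differentiable (by simp)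
  have hint := aux_integrable σ ω hσ hω η hη C hC
  have ηpos : ∀ θ ∈ Ioo (0 : ℝ) π, 0 < η θ := by
    intro θ hθ
    have := Real.sin_pos_of_mem_Ioo hθ
    rw [hη]; positivity
  -- bound on the derivative of ω
  obtain ⟨K, hK⟩ : ∃ K, ∀ θ ∈ Ioo (0 : ℝ) π, |deriv ω θ| ≤ K * Real.sin θ ^ 2 := by
    obtain ⟨D, hD⟩ := (isCompact_Icc (a := (0 : ℝ)) (b := π)).exists_bound_of_continuousOn
      (f := fun θ => Real.exp (σ θ)) (by have := dσ.continuous; fun_prop)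
    refine ⟨C * D, fun θ hθ => ?_⟩
    have h1 := hC θ hθ
    have h2 := hD θ ⟨hθ.1.le, hθ.2.le⟩
    rw [Real.norm_eq_abs, Real.abs_exp] at h2
    have h3 := ηpos θ hθ
    rw [abs_div, abs_of_pos h3, div_le_iff₀ h3] at h1
    have hC0 : 0 ≤ C := (abs_nonneg _).trans (hC θ hθ)
    calc _ ≤ C * η θ := h1
      _ = C * (Real.exp (σ θ) * Real.sin θ ^ 2) := by rw [hη]
      _ ≤ C * (D * Real.sin θ ^ 2) := by gcongr
      _ = _ := by ring
  have cL := aux_cont ω dω K hK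
  have cR : ContinuousOn (fun θ => (ω θ - ω π) / (1 + Real.cos θ)) (Icc 0 π) := by
    have := aux_cont (fun θ => ω (π - θ)) (by fun_prop) K (by
      intro θ hθ
      rw [deriv_comp_const_sub, abs_neg]
      have := hK (π - θ) ⟨by linarith [hθ.2], by linarith [hθ.1]⟩
      rwa [Real.sin_pi_sub] at this)
    have h2 := this.comp (f := fun θ => π - θ) (s := Icc 0 π) (by fun_prop)
      (fun θ hθ => ⟨by linarith [hθ.2], by linarith [hθ.1]⟩)
    refine h2.congr (fun θ _ => ?_)
    simp [Real.cos_pi_sub]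
  rw [hω0] at cL
  rw [hωπ] at cR
  have cσ := dσ.continuous
  have hcos1 : ∀ θ ∈ Icc (0 : ℝ) π, 0 < θ → 0 < 1 - Real.cos θ := by
    intro θ hθ h
    have := Real.cos_lt_cos_of_nonneg_of_le_pi le_rfl hθ.2 h
    rw [Real.cos_zero] at this
    linarith
  have hcos2 : ∀ θ ∈ Icc (0 : ℝ) π, θ < π → 0 < 1 + Real.cos θ := by
    intro θ hθ h
    have := Real.cos_lt_cos_of_nonneg_of_le_pi hθ.1 le_rfl h
    rw [Real.cos_pi] at this
    linarith
  obtain ⟨P, hP⟩ : ∃ P : ℝ → ℝ, P = fun θ => ((ω θ - 4 * J) / (1 - Real.cos θ)) ^ 2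
    + (Real.exp (σ θ) * (1 + Real.cos θ)) ^ 2 := ⟨_, rfl⟩
  obtain ⟨Q, hQ⟩ : ∃ Q : ℝ → ℝ, Q = fun θ => ((ω θ - -(4 * J)) / (1 + Real.cos θ)) ^ 2
    + (Real.exp (σ θ) * (1 - Real.cos θ)) ^ 2 := ⟨_, rfl⟩
  have cP : ContinuousOn P (Icc 0 π) := by
    rw [hP]
    exact (cL.pow 2).add (by fun_prop)
  have cQ : ContinuousOn Q (Icc 0 π) := by
    rw [hQ]
    exact (cR.pow 2).add (by fun_prop)
  have P0 : P 0 = 4 * Real.exp (σ 0) ^ 2 := by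
    rw [hP]; simp [hω0]; ring
  have Pπ : P π = (4 * J) ^ 2 := by
    rw [hP]; simp [hωπ]; ring
  have Q0 : Q 0 = (4 * J) ^ 2 := by
    rw [hQ]; simp [hω0]; ring
  have Qπ : Q π = 4 * Real.exp (σ π) ^ 2 := by
    rw [hQ]; simp [hωπ]; ring
  have Ppos : ∀ θ ∈ Icc (0 : ℝ) π, 0 < P θ := by
    intro θ hθ
    rcases eq_or_lt_of_le hθ.2 with h | h
    · rw [h, Pπ]; positivity
    · have := hcos2 θ hθ h
      rw [hP]; positivity
  have Qpos : ∀ θ ∈ Icc (0 : ℝ) π, 0 < Q θ := by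
    intro θ hθ
    rcases eq_or_lt_of_le hθ.1 with h | h
    · rw [← h, Q0]; positivity
    · have := hcos1 θ hθ h
      rw [hQ]; positivity
  obtain ⟨G, hG⟩ : ∃ G : ℝ → ℝ, G = fun θ => 2 * Real.log (P θ) - 2 * Real.log (Q θ)
    - 4 * Real.cos θ - 4 * σ θ * Real.cos θ := ⟨_, rfl⟩
  have cG : ContinuousOn G (Icc 0 π) := by
    rw [hG]
    have h1 := cP.log (fun θ hθ => (Ppos θ hθ).ne')
    have h2 := cQ.log (fun θ hθ => (Qpos θ hθ).ne')
    exact (((h1.const_mul 2).sub (h2.const_mul 2)).sub (by fun_prop)).sub (by fun_prop)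
  have eG : ∀ θ ∈ Ioo (0 : ℝ) π, G θ = 2 * Real.log ((ω θ - 4 * J) ^ 2 + (η θ) ^ 2)
      - 2 * Real.log ((ω θ + 4 * J) ^ 2 + (η θ) ^ 2)
      - 4 * Real.log (1 - Real.cos θ) + 4 * Real.log (1 + Real.cos θ)
      - 4 * Real.cos θ - 4 * σ θ * Real.cos θ := by
    intro θ hθ
    have h1 := hcos1 θ ⟨hθ.1.le, hθ.2.le⟩ hθ.1
    have h2 := hcos2 θ ⟨hθ.1.le, hθ.2.le⟩ hθ.2
    have h3 := ηpos θ hθ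
    have h4 : Real.sin θ ^ 2 = (1 - Real.cos θ) * (1 + Real.cos θ) := by
      rw [Real.sin_sq]; ring
    have e1 : P θ = ((ω θ - 4 * J) ^ 2 + (η θ) ^ 2) / (1 - Real.cos θ) ^ 2 := by
      rw [hP, hη]; simp only [h4]; field_simp
    have e2 : Q θ = ((ω θ + 4 * J) ^ 2 + (η θ) ^ 2) / (1 + Real.cos θ) ^ 2 := by
      rw [hQ, hη]; simp only [h4]; field_simp; ring
    rw [hG]
    simp only
    rw [e1, e2, Real.log_div (by positivity) (by positivity),
      Real.log_div (by positivity) (by positivity), Real.log_pow, Real.log_pow]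
    push_cast
    ring
  have dη : ∀ θ, HasDerivAt η (Real.exp (σ θ) * deriv σ θ * Real.sin θ ^ 2
      + Real.exp (σ θ) * (2 * Real.sin θ * Real.cos θ)) θ := by
    intro θ
    rw [hη]
    have := (dσ θ).hasDerivAt.exp.fun_mul ((Real.hasDerivAt_sin θ).fun_pow 2)
    simpa using this
  have dG : ∀ θ ∈ Ioo (0 : ℝ) π, ∃ g', HasDerivAt G g' θ ∧ g' ≤
      ((deriv σ θ) ^ 2 + 4 * σ θ + (deriv ω θ) ^ 2 / (η θ) ^ 2) * Real.sin θ := by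
    intro θ hθ
    have h1 := hcos1 θ ⟨hθ.1.le, hθ.2.le⟩ hθ.1
    have h2 := hcos2 θ ⟨hθ.1.le, hθ.2.le⟩ hθ.2
    have h3 := ηpos θ hθ
    have hs := Real.sin_pos_of_mem_Ioo hθ
    have ev : G =ᶠ[nhds θ] _ := Filter.eventuallyEq_of_mem (Ioo_mem_nhds hθ.1 hθ.2) eG
    have d1 := ((((dω θ).hasDerivAt.sub_const (4 * J)).fun_pow 2).fun_add
      ((dη θ).fun_pow 2)).log (by positivity)
    have d2 := ((((dω θ).hasDerivAt.add_const (4 * J)).fun_pow 2).fun_add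
      ((dη θ).fun_pow 2)).log (by positivity)
    have d3 := ((Real.hasDerivAt_cos θ).const_sub 1).log h1.ne'
    have d4 := ((Real.hasDerivAt_cos θ).const_add 1).log h2.ne'
    have d5 := ((dσ θ).hasDerivAt.const_mul 4).fun_mul (Real.hasDerivAt_cos θ)
    have d := (((((d1.const_mul 2).fun_sub (d2.const_mul 2)).fun_sub (d3.const_mul 4)).fun_add
      (d4.const_mul 4)).fun_sub ((Real.hasDerivAt_cos θ).const_mul 4)).fun_sub d5
    refine ⟨_, d.congr_of_eventuallyEq ev, ?_⟩
    have key := aux_ineq (Real.sin θ) (Real.cos θ) (Real.exp (σ θ)) (deriv σ θ) (deriv ω θ)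
      (ω θ - 4 * J) (4 * J) _ _ (deriv σ θ + 2 * Real.cos θ / Real.sin θ) (deriv ω θ / η θ)
      (η θ) hs (Real.sin_sq_add_cos_sq θ) (Real.exp_pos _) (by rw [hη]) (by ring)
      (by field_simp) rfl rfl
    have r1 : ω θ - 4 * J + 2 * (4 * J) = ω θ + 4 * J := by ring
    have r2 : η θ * (deriv σ θ + 2 * Real.cos θ / Real.sin θ) =
      Real.exp (σ θ) * deriv σ θ * Real.sin θ ^ 2
      + Real.exp (σ θ) * (2 * Real.sin θ * Real.cos θ) := by
      rw [hη]; field_simp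
    have r3 : 8 / Real.sin θ = 4 * (Real.sin θ / (1 - Real.cos θ))
        + 4 * (Real.sin θ / (1 + Real.cos θ)) := by
      field_simp
      have := Real.sin_sq θ
      rw [this]
      ring
    rw [r1, r2, r3] at key
    simp only [neg_neg, neg_div, mul_neg, Nat.cast_ofNat, Nat.add_one_sub_one, pow_one, Nat.reduceSub]
    refine le_of_eq_of_le ?_ (le_of_le_of_eq (add_le_add_left key (4 * σ θ * Real.sin θ)) ?_)
    · ring
    · ring
  choose! g' hg' using dG
  have main := intervalIntegral.sub_le_integral_of_hasDeriv_right_of_le pi_pos.le cG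
    (fun θ hθ => (hg' θ hθ).1.hasDerivWithinAt) hint (fun θ hθ => (hg' θ hθ).2)
  rw [← hM] at main
  have hlog4 : Real.log 4 = 2 * Real.log 2 := by
    rw [show (4 : ℝ) = 2 ^ 2 by norm_num, Real.log_pow]; norm_num
  have ee : ∀ x : ℝ, Real.log (4 * Real.exp x ^ 2) = 2 * Real.log 2 + 2 * x := by
    intro x
    rw [Real.log_mul (by norm_num) (by positivity), Real.log_pow, Real.log_exp, hlog4]
    norm_num
  have ej : Real.log ((4 * J) ^ 2) = 4 * Real.log 2 + 2 * Real.log |J| := by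
    rw [Real.log_pow, Real.log_mul (by norm_num) hJ, hlog4, Real.log_abs]
    push_cast; ring
  rw [hG] at main
  simp only [P0, Pπ, Q0, Qπ, ee, ej, Real.cos_zero, Real.cos_pi] at main
  have hJp : 0 < |J| := abs_pos.2 hJ
  rw [← Real.log_le_iff_le_exp (by positivity), Real.log_mul (by norm_num) hJp.ne']
  linarith
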